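/- arXiv:2405.12733 — 2 statements merged into one kernel-verified Lean document; each statement's English description precedes it below -/
import Mathlib

section
/- Let G be a connected finite simple graph with maximum degree Δ(G) ≥ 3 that is not the complete bipartite graph K_{Δ(G),Δ(G)}. Then the list-distinguishing chromatic number of G is at most 2Δ(G) − 1. -/
open SimpleGraph

/-- `f` is a proper coloring of `G` preserved by no nontrivial automorphism of `G`. -/
def IsProperDistinguishing {V : Type*} (G : SimpleGraph V) (f : V → ℕ) : Prop :=
  (∀ ⦃u w : V⦄, G.Adj u w → f u ≠ f w) ∧
    ∀ φ : G ≃g G, (∀ v, f (φ v) = f v) → ∀ v, φ v = v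

/-- `G` is properly `L`-distinguishable for every list assignment with all lists of size `k`. -/
def ProperlyListDistinguishable {V : Type*} (G : SimpleGraph V) (k : ℕ) : Prop :=
  ∀ L : V → Finset ℕ, (∀ v, (L v).card = k) →
    ∃ f : V → ℕ, (∀ v, f v ∈ L v) ∧ IsProperDistinguishing G f

/-- The list-distinguishing chromatic number `χ_{D_L}(G)`. -/
noncomputable def listDistChromNum {V : Type*} (G : SimpleGraph V) : ℕ :=
  sInf {k | ProperlyListDistinguishable G k}

namespace ListDist

open Finset

variable {V : Type*}

/-- Greedy list coloring along a degenerate order. -/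
theorem greedy [DecidableEq V] (H : V → V → Prop) (hH : ∀ u v, H u v → H v u)
    (L : V → Finset ℕ) (U : Finset V)
    (h : ∀ T ⊆ U, T.Nonempty → ∃ v ∈ T, ∃ F : Finset V,
      (∀ u ∈ T, u ≠ v → H u v → u ∈ F) ∧ F.card < (L v).card) :
    ∃ g : V → ℕ, (∀ v ∈ U, g v ∈ L v) ∧ ∀ u ∈ U, ∀ v ∈ U, u ≠ v → H u v → g u ≠ g v := by
  induction U using Finset.strongInduction with
  | H U ih =>
    by_cases hU : U.Nonempty
    · obtain ⟨v, hv, F, hF, hc⟩ := h U Subset.rfl hU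
      obtain ⟨g, hg1, hg2⟩ := ih (U.erase v) (erase_ssubset hv)
        (fun T hT => h T (hT.trans (erase_subset _ _)))
      have : (F.image g).card < (L v).card := lt_of_le_of_lt card_image_le hc
      obtain ⟨a, ha, ha'⟩ := exists_mem_notMem_of_card_lt_card this
      have hne : ∀ u ∈ U, u ≠ v → H u v → g u ≠ a := by
        intro u hu huv hH e
        exact ha' (mem_image.2 ⟨u, hF u hu huv hH, e⟩)
      refine ⟨Function.update g v a, ?_, ?_⟩
      · intro w hw
        by_cases hwv : w = v
        · subst hwv; simpa using ha
        · rw [Function.update_of_ne hwv]; exact hg1 w (mem_erase.2 ⟨hwv, hw⟩)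
      · intro u hu w hw huw hHuw
        by_cases huv : u = v
        · subst huv
          rw [Function.update_self, Function.update_of_ne huw.symm]
          exact (hne w hw huw.symm (hH _ _ hHuw)).symm
        · rw [Function.update_of_ne huv]
          by_cases hwv : w = v
          · subst hwv
            rw [Function.update_self]
            exact hne u hu huw hHuw
          · rw [Function.update_of_ne hwv]
            exact hg2 u (mem_erase.2 ⟨huv, hu⟩) w (mem_erase.2 ⟨hwv, hw⟩) huw hHuw
    · rw [not_nonempty_iff_eq_empty] at hU
      subst hU
      exact ⟨fun _ => 0, by simp, by simp⟩

/-- `u` and `v` are at the same distance from `x` with the same neighbors closer to `x`. -/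
def Sib (G : SimpleGraph V) (x u v : V) : Prop :=
  G.dist x u = G.dist x v ∧ ∀ p, G.dist x p < G.dist x v → (G.Adj p u ↔ G.Adj p v)

theorem Sib.symm {G : SimpleGraph V} {x u v : V} (h : Sib G x u v) : Sib G x v u :=
  ⟨h.1.symm, fun p hp => (h.2 p (h.1 ▸ hp)).symm⟩

theorem dist_iso_le {G : SimpleGraph V} (hG : G.Connected) (φ : G ≃g G) (u v : V) :
    G.dist (φ u) (φ v) ≤ G.dist u v := by
  obtain ⟨p, hp⟩ := hG.exists_walk_length_eq_dist u v
  rw [← hp, ← Walk.length_map φ.toHom p]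
  exact dist_le _

theorem dist_iso {G : SimpleGraph V} (hG : G.Connected) (φ : G ≃g G) (u v : V) :
    G.dist (φ u) (φ v) = G.dist u v := by
  refine le_antisymm (dist_iso_le hG φ u v) ?_
  simpa using dist_iso_le hG φ.symm (φ u) (φ v)

theorem exists_down {G : SimpleGraph V} (hG : G.Connected) {x v : V} (h : v ≠ x) :
    ∃ p, G.Adj p v ∧ G.dist x p < G.dist x v := by
  obtain ⟨w, hw⟩ := hG.exists_walk_length_eq_dist v x
  cases w with
  | nil => exact absurd rfl h
  | cons hadj q =>
    refine ⟨_, hadj.symm, ?_⟩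
    rw [dist_comm (u := x), dist_comm (u := x), ← hw, Walk.length_cons]
    exact Nat.lt_succ_of_le (dist_le q)

/-- An automorphism fixing the root and separated on siblings is trivial. -/
theorem fix {G : SimpleGraph V} (hG : G.Connected) (x : V) (f : V → ℕ) (φ : G ≃g G)
    (hf : ∀ v, f (φ v) = f v) (hx : φ x = x)
    (h : ∀ u v, u ≠ x → v ≠ x → u ≠ v → Sib G x u v → φ u = u ∨ φ v = v ∨ f u ≠ f v) :
    ∀ v, φ v = v := by
  suffices H : ∀ n, ∀ v, G.dist x v = n → φ v = v from fun v => H _ v rfl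
  intro n
  induction n using Nat.strong_induction_on with
  | _ n ih =>
    intro v hv
    by_contra hne
    have hvx : v ≠ x := by rintro rfl; exact hne hx
    have hvx' : φ v ≠ x := by
      intro e; rw [← hx] at e; exact hvx (φ.injective e)
    have hd : G.dist x (φ v) = G.dist x v := by
      have := dist_iso hG φ x v
      rwa [hx] at this
    have hs : Sib G x (φ v) v := by
      refine ⟨hd, fun p hp => ?_⟩
      have hp' := ih _ (hv ▸ hp) p rfl
      conv_lhs => rw [← hp']
      exact φ.map_adj_iff
    rcases h _ _ hvx' hvx hne hs with e | e | e
    · exact hne (φ.injective e)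
    · exact hne e
    · exact e (hf v)

theorem count [DecidableEq V] {G : SimpleGraph V} [G.LocallyFinite] {n : ℕ}
    (hn : 3 ≤ n) (hd : ∀ v, #(G.neighborFinset v) ≤ n)
    {x v p q : V} {T : Finset V} (hpv : G.Adj p v) (hdp : G.dist x p < G.dist x v) (hpT : p ∉ T)
    (hpq : G.Adj p q) (hqv : q ≠ v) (hq : q ∈ T → ¬ Sib G x q v) :
    ∃ F : Finset V, (∀ u ∈ T, u ≠ v → (G.Adj u v ∨ Sib G x u v) → u ∈ F) ∧ #F ≤ 2 * n - 3 := by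
  refine ⟨(G.neighborFinset v).erase p ∪ ((G.neighborFinset p).erase v).erase q, ?_, ?_⟩
  · intro u hu huv h
    rw [mem_union]
    rcases h with h | h
    · left
      simp only [mem_erase, mem_neighborFinset]
      exact ⟨by rintro rfl; exact hpT hu, h.symm⟩
    · right
      simp only [mem_erase, mem_neighborFinset]
      exact ⟨by rintro rfl; exact hq hu h, huv, (h.2 p hdp).2 hpv⟩
  · refine (card_union_le _ _).trans ?_
    have h1 := hd v
    have h2 := hd p
    have m1 : p ∈ G.neighborFinset v := by simpa using hpv.symm
    have m2 : v ∈ G.neighborFinset p := by simpa using hpv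
    have m3 : q ∈ (G.neighborFinset p).erase v := by simp [hqv, hpq]
    have := card_pos.2 ⟨_, m3⟩
    rw [card_erase_of_mem m1, card_erase_of_mem m3, card_erase_of_mem m2] at *
    omega

/-- The counting step for a vertex of `T` closest to the root, when some neighbor `y` of the
root is not in `T`. -/
theorem count_min [DecidableEq V] {G : SimpleGraph V} [G.LocallyFinite] (hG : G.Connected) {n : ℕ}
    (hn : 3 ≤ n) (hd : ∀ v, #(G.neighborFinset v) ≤ n)
    {x y : V} {T : Finset V} (hT : T.Nonempty) (hx : x ∉ T) (hxy : G.Adj x y) (hy : y ∉ T) :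
    ∃ v ∈ T, ∃ F : Finset V,
      (∀ u ∈ T, u ≠ v → (G.Adj u v ∨ Sib G x u v) → u ∈ F) ∧ #F ≤ 2 * n - 3 := by
  obtain ⟨v, hv, hmin⟩ := exists_min_image T (fun v => G.dist x v) hT
  refine ⟨v, hv, ?_⟩
  have hvx : v ≠ x := by rintro rfl; exact hx hv
  obtain ⟨p, hpv, hdp⟩ := exists_down hG hvx
  have hpT : p ∉ T := fun h => absurd (hmin p h) (by omega)
  by_cases hpx : p = x
  · subst hpx
    exact count hn hd hpv hdp hpT hxy (by rintro rfl; exact hy hv) (fun h => absurd h hy)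
  · obtain ⟨q, hqp, hdq⟩ := exists_down hG hpx
    exact count hn hd hpv hdp hpT hqp.symm (by rintro rfl; omega)
      (fun _ h => by have := h.1; omega)

/-- Good colorings exist. -/
def Good (G : SimpleGraph V) (L : V → Finset ℕ) : Prop :=
  ∃ f : V → ℕ, (∀ v, f v ∈ L v) ∧ IsProperDistinguishing G f

theorem root [Fintype V] [DecidableEq V] {G : SimpleGraph V} [G.LocallyFinite]
    (hG : G.Connected) {n : ℕ}
    (hn : 3 ≤ n) (hd : ∀ v, #(G.neighborFinset v) ≤ n) {L : V → Finset ℕ}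
    (hL : ∀ v, #(L v) = 2 * n - 1)
    {x y : V} {c : ℕ} (hc : c ∈ L x) (hxy : G.Adj x y)
    (h : ∀ T : Finset V, x ∉ T → y ∈ T → ∃ v ∈ T, ∃ F : Finset V,
      (∀ u ∈ T, u ≠ v → (G.Adj u v ∨ Sib G x u v) → u ∈ F) ∧ #F < #((L v).erase c)) :
    Good G L := by
  have hLc : ∀ v, 2 * n - 2 ≤ #((L v).erase c) := fun v => by
    have := pred_card_le_card_erase (s := L v) (a := c)
    rw [hL] at this
    omega
  obtain ⟨g, hg1, hg2⟩ := greedy (fun u v => G.Adj u v ∨ Sib G x u v)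
    (fun u v h => h.imp (fun h => h.symm) (fun h => h.symm))
    (fun v => (L v).erase c) (univ.erase x) (by
      intro T hT hne
      have hx : x ∉ T := fun hx => by simpa using hT hx
      by_cases hy : y ∈ T
      · exact h T hx hy
      · obtain ⟨v, hv, F, hF, hcard⟩ := count_min hG hn hd hne hx hxy hy
        refine ⟨v, hv, F, hF, lt_of_le_of_lt hcard (lt_of_lt_of_le ?_ (hLc v))⟩
        omega)
  have hgc : ∀ v, v ≠ x → g v ∈ L v ∧ g v ≠ c := by
    intro v hv
    have := hg1 v (by simp [hv])
    rw [mem_erase] at this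
    exact this.symm
  have hg3 : ∀ u v, u ≠ x → v ≠ x → u ≠ v → (G.Adj u v ∨ Sib G x u v) → g u ≠ g v :=
    fun u v hu hv => hg2 u (by simp [hu]) v (by simp [hv])
  have hfx : Function.update g x c x = c := Function.update_self ..
  have hfn : ∀ v, v ≠ x → Function.update g x c v = g v := fun v hv => Function.update_of_ne hv ..
  refine ⟨Function.update g x c, ?_, ?_, ?_⟩
  · intro v
    by_cases hv : v = x
    · subst hv; rw [hfx]; exact hc
    · rw [hfn v hv]; exact (hgc v hv).1
  · intro u w huw
    by_cases hu : u = x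
    · subst hu
      rw [hfx, hfn w huw.ne.symm]; exact (hgc w huw.ne.symm).2.symm
    · by_cases hw : w = x
      · subst hw
        rw [hfx, hfn u huw.ne]; exact (hgc u huw.ne).2
      · rw [hfn u hu, hfn w hw]
        exact hg3 u w hu hw huw.ne (Or.inl huw)
  · intro φ hφ
    refine fix hG x _ φ hφ ?_ ?_
    · by_contra hne
      have := hφ x
      rw [hfx, hfn _ hne] at this
      exact (hgc _ hne).2 this
    · intro u v hu hv huv hs
      right; right
      rw [hfn u hu, hfn v hv]
      exact hg3 u v hu hv huv (Or.inr hs)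

section cases

variable [Fintype V] [DecidableEq V] {G : SimpleGraph V} [G.LocallyFinite]
  {n : ℕ} {L : V → Finset ℕ}

theorem case_b (hG : G.Connected) (hn : 3 ≤ n) (hd : ∀ v, #(G.neighborFinset v) ≤ n)
    (hL : ∀ v, #(L v) = 2 * n - 1) {x y : V} (hxy : G.Adj x y)
    (h : #((G.neighborFinset y).erase x ∪ (G.neighborFinset x).erase y) ≤ 2 * n - 3) :
    Good G L := by
  obtain ⟨c, hc⟩ : (L x).Nonempty := by rw [← card_pos, hL]; omega
  refine root hG hn hd hL hc hxy fun T hx hy => ⟨y, hy, _, ?_, lt_of_le_of_lt h ?_⟩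
  · intro u hu huy hH
    simp only [mem_union, mem_erase, mem_neighborFinset]
    rcases hH with hH | hH
    · exact Or.inl ⟨by rintro rfl; exact hx hu, hH.symm⟩
    · refine Or.inr ⟨huy, (hH.2 x ?_).2 hxy⟩
      rw [dist_self]; exact hG.pos_dist_of_ne hxy.ne
  · have := pred_card_le_card_erase (s := L y) (a := c)
    rw [hL] at this
    omega

theorem case_c (hG : G.Connected) (hn : 3 ≤ n) (hd : ∀ v, #(G.neighborFinset v) ≤ n)
    (hL : ∀ v, #(L v) = 2 * n - 1) {x y z : V} {c : ℕ} (hc : c ∈ L x)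
    (hxy : G.Adj x y) (hyz : G.Adj y z) (hxz : x ≠ z) (hxz' : ¬ G.Adj x z) (S : Finset V)
    (hS : ∀ u, u ≠ x → u ≠ z → G.Adj y u → Sib G x u z → u ∈ S)
    (h : n + #S < #((L z).erase c)) :
    Good G L := by
  have hdxy : G.dist x y = 1 := dist_eq_one_iff_adj.2 hxy
  have hdxz : 1 < G.dist x z := hG.one_lt_dist_of_ne_of_not_adj hxz hxz'
  refine root hG hn hd hL hc hxy fun T hx hy => ?_
  by_cases hz : z ∈ T
  · refine ⟨z, hz, G.neighborFinset z ∪ S, ?_, ?_⟩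
    · intro u hu huz hH
      rw [mem_union, mem_neighborFinset]
      refine hH.imp (fun h => h.symm) (fun h => hS u (by rintro rfl; exact hx hu) huz ?_ h)
      exact (h.2 y (by omega)).2 hyz
    · have := card_union_le (G.neighborFinset z) S
      have := hd z
      omega
  · refine ⟨y, hy, ((G.neighborFinset y).erase x).erase z ∪ (G.neighborFinset x).erase y, ?_, ?_⟩
    · intro u hu huy hH
      simp only [mem_union, mem_erase, mem_neighborFinset]
      rcases hH with hH | hH
      · exact Or.inl ⟨by rintro rfl; exact hz hu, by rintro rfl; exact hx hu, hH.symm⟩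
      · refine Or.inr ⟨huy, (hH.2 x ?_).2 hxy⟩
        rw [dist_self]; omega
    · have h0 := pred_card_le_card_erase (s := L y) (a := c)
      rw [hL] at h0
      refine lt_of_le_of_lt (card_union_le _ _) ?_
      have m1 : x ∈ G.neighborFinset y := by simpa using hxy.symm
      have m2 : z ∈ (G.neighborFinset y).erase x := by simp [hxz.symm, hyz]
      have m3 : y ∈ G.neighborFinset x := by simpa using hxy
      have h1 := hd x
      have h2 := hd y
      have := card_pos.2 ⟨_, m2⟩
      rw [card_erase_of_mem m2, card_erase_of_mem m3, card_erase_of_mem m1] at *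
      omega

theorem case_d (hG : G.Connected) (hn : 3 ≤ n) (hd : ∀ v, #(G.neighborFinset v) ≤ n)
    (hL : ∀ v, #(L v) = 2 * n - 1)
    (htri : ∀ a b c, G.Adj a b → G.Adj b c → ¬ G.Adj a c)
    (hC4 : ∀ a b p q, a ≠ b → G.Adj a p → G.Adj b p → G.Adj a q → G.Adj b q → p = q)
    {z y x t u : V} (hzy : G.Adj z y) (hyx : G.Adj y x) (hxt : G.Adj x t) (htu : G.Adj t u)
    (hzx : z ≠ x) (hyt : y ≠ t) (hxu : x ≠ u) (hzu : ¬ G.Adj z u)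
    {c : ℕ} (hcx : c ∈ L x) (hcz : c ∈ L z) (hcu : c ∈ L u) : Good G L := by
  have hzu' : z ≠ u := by
    rintro rfl
    exact hyt (hC4 x z y t hzx.symm hyx.symm hzy hxt htu.symm)
  have hLc : ∀ v, 2 * n - 2 ≤ #((L v).erase c) := fun v => by
    have := pred_card_le_card_erase (s := L v) (a := c)
    rw [hL] at this
    omega
  obtain ⟨P, hP⟩ : ∃ P : Finset V, P = {x, z, u} := ⟨_, rfl⟩
  have memP : ∀ v, v ∈ P ↔ v = x ∨ v = z ∨ v = u := by intro v; simp [hP]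
  have hxP : x ∈ P := by simp [memP]
  have hzP : z ∈ P := by simp [memP]
  have huP : u ∈ P := by simp [memP]
  have hPind : ∀ a ∈ P, ∀ b ∈ P, ¬ G.Adj a b := by
    have h1 : ¬ G.Adj x z := htri x y z hyx.symm hzy.symm
    have h2 : ¬ G.Adj x u := htri x t u hxt htu
    intro a ha b hb hab
    rw [memP] at ha hb
    rcases ha with rfl | rfl | rfl <;> rcases hb with rfl | rfl | rfl <;>
      first
      | exact hab.ne rfl
      | exact h1 hab
      | exact h2 hab
      | exact hzu hab
      | exact h1 hab.symm
      | exact h2 hab.symm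
      | exact hzu hab.symm
  obtain ⟨C, hC⟩ : ∃ C : V → V → Finset V,
    C = fun a b => G.neighborFinset a ∩ G.neighborFinset b := ⟨_, rfl⟩
  have memC : ∀ a b v, v ∈ C a b ↔ G.Adj a v ∧ G.Adj b v := by intro a b v; simp [hC]
  have cardC : ∀ a b, a ≠ b → #(C a b) ≤ 1 := by
    intro a b hab
    rw [card_le_one]
    intro p hp q hq
    rw [memC] at hp hq
    exact hC4 a b p q hab hp.1 hp.2 hq.1 hq.2
  obtain ⟨W, hW⟩ : ∃ W : Finset V, W = C x z ∪ C x u ∪ C z u := ⟨_, rfl⟩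
  have memW : ∀ v, ∀ a ∈ P, ∀ b ∈ P, a ≠ b → G.Adj a v → G.Adj b v → v ∈ W := by
    intro v a ha b hb hab h1 h2
    rw [memP] at ha hb
    simp only [hW, mem_union, memC]
    rcases ha with rfl | rfl | rfl <;> rcases hb with rfl | rfl | rfl <;> tauto
  have hyW : y ∈ W := memW y z hzP x hxP hzx hzy hyx.symm
  have htW : t ∈ W := memW t x hxP u huP hxu hxt htu.symm
  have Wimg : ∀ φ : G ≃g G, (∀ v ∈ P, φ v ∈ P) → ∀ v ∈ W, φ v ∈ W := by
    intro φ hφ v hv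
    have aux : ∀ a b, a ∈ P → b ∈ P → a ≠ b → v ∈ C a b → φ v ∈ W := by
      intro a b ha hb hab hv
      rw [memC] at hv
      exact memW _ (φ a) (hφ a ha) (φ b) (hφ b hb) (fun e => hab (φ.injective e))
        (φ.map_adj_iff.2 hv.1) (φ.map_adj_iff.2 hv.2)
    rw [hW, mem_union, mem_union] at hv
    rcases hv with (hv | hv) | hv
    · exact aux _ _ hxP hzP hzx.symm hv
    · exact aux _ _ hxP huP hxu hv
    · exact aux _ _ hzP huP hzu' hv
  have cardW : #W ≤ 3 := by
    have h1 := cardC x z hzx.symm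
    have h2 := cardC x u hxu
    have h3 := cardC z u hzu'
    have h4 := card_union_le (C x z ∪ C x u) (C z u)
    have h5 := card_union_le (C x z) (C x u)
    rw [hW]
    omega
  -- the vertices `y` and `t` have few conflicts
  have key : ∀ s r, G.Adj x s → G.Adj s r → r ≠ x → r ∈ P → s ∈ W →
      #(((G.neighborFinset s).erase x).erase r ∪ W.erase s) ≤ n := by
    intro s r h1 h2 h3 _ h5
    refine (card_union_le _ _).trans ?_
    have m1 : x ∈ G.neighborFinset s := by simpa using h1.symm
    have m2 : r ∈ (G.neighborFinset s).erase x := by simp [h3, h2]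
    have := hd s
    have := card_pos.2 ⟨_, m2⟩
    rw [card_erase_of_mem m2, card_erase_of_mem h5, card_erase_of_mem m1] at *
    omega
  obtain ⟨g, hg1, hg2⟩ := greedy
    (fun a b => G.Adj a b ∨ (Sib G x a b ∧ (a ≠ y ∧ a ≠ t) ∧ (b ≠ y ∧ b ≠ t)) ∨ (a ∈ W ∧ b ∈ W))
    (fun a b h => h.imp (fun h => h.symm)
      (fun h => h.imp (fun h => ⟨h.1.symm, h.2.2, h.2.1⟩) (fun h => h.symm)))
    (fun v => (L v).erase c) (univ \ P) (by
      intro T hT hne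
      have hTP : ∀ v ∈ T, v ∉ P := fun v hv => by simpa using hT hv
      have key' : ∀ s r, G.Adj x s → G.Adj s r → r ≠ x → r ∈ P → s ∈ W → s ∈ T →
          (s = y ∨ s = t) → _ := fun s r h1 h2 h3 h4 h5 h6 h7 =>
        (⟨s, h6, ((G.neighborFinset s).erase x).erase r ∪ W.erase s, by
          intro a ha has h
          simp only [mem_union, mem_erase, mem_neighborFinset]
          rcases h with h | h | h
          · exact Or.inl ⟨by rintro rfl; exact hTP _ ha h4, by rintro rfl; exact hTP _ ha hxP,
              h.symm⟩
          · have := h.2.2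
            tauto
          · exact Or.inr ⟨has, h.1⟩, by
          refine lt_of_le_of_lt (key s r h1 h2 h3 h4 h5) (lt_of_lt_of_le ?_ (hLc s))
          omega⟩ : ∃ v ∈ T, ∃ F : Finset V, (∀ a ∈ T, a ≠ v → (G.Adj a v ∨
            (Sib G x a v ∧ (a ≠ y ∧ a ≠ t) ∧ (v ≠ y ∧ v ≠ t)) ∨ (a ∈ W ∧ v ∈ W)) → a ∈ F) ∧
            #F < #((L v).erase c))
      by_cases hy : y ∈ T
      · exact key' y z hyx.symm hzy.symm hzx hzP hyW hy (Or.inl rfl)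
      by_cases ht : t ∈ T
      · exact key' t u hxt htu hxu.symm huP htW ht (Or.inr rfl)
      obtain ⟨v, hv, F, hF, hcard⟩ := count_min hG hn hd hne
        (fun h => hTP x h hxP) hyx.symm hy
      refine ⟨v, hv, F, ?_, lt_of_le_of_lt hcard (lt_of_lt_of_le ?_ (hLc v))⟩
      · intro a ha hav h
        rcases h with h | h | h
        · exact hF a ha hav (Or.inl h)
        · exact hF a ha hav (Or.inr h.1)
        · exfalso
          have m : t ∈ W.erase y := by simp [hyt.symm, htW]
          have : #((W.erase y).erase t) ≤ 1 := by
            rw [card_erase_of_mem m, card_erase_of_mem hyW]; omega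
          rw [card_le_one] at this
          refine hav (this a ?_ v ?_)
          · simp only [mem_erase]
            exact ⟨by rintro rfl; exact ht ha, by rintro rfl; exact hy ha, h.1⟩
          · simp only [mem_erase]
            exact ⟨by rintro rfl; exact ht hv, by rintro rfl; exact hy hv, h.2⟩
      · omega)
  have hgc : ∀ v, v ∉ P → g v ∈ L v ∧ g v ≠ c := by
    intro v hv
    have := hg1 v (by simp [hv])
    rw [mem_erase] at this
    exact this.symm
  obtain ⟨f, hf⟩ : ∃ f : V → ℕ, f = fun v => if v ∈ P then c else g v := ⟨_, rfl⟩
  have hfP : ∀ v ∈ P, f v = c := fun v hv => by simp [hf, hv]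
  have hfn : ∀ v, v ∉ P → f v = g v := fun v hv => by simp [hf, hv]
  have hfc : ∀ v, f v = c → v ∈ P := by
    intro v h
    by_contra hv
    rw [hfn v hv] at h
    exact (hgc v hv).2 h
  have hWP : ∀ v ∈ W, v ∉ P := by
    intro v hv hvP
    have aux : ∀ a b, a ∈ P → v ∈ C a b → False := fun a b ha h =>
      hPind a ha v hvP ((memC _ _ _).1 h).1
    rw [hW, mem_union, mem_union] at hv
    rcases hv with (hv | hv) | hv
    · exact aux _ _ hxP hv
    · exact aux _ _ hxP hv
    · exact aux _ _ hzP hv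
  refine ⟨f, ?_, ?_, ?_⟩
  · intro v
    by_cases hv : v ∈ P
    · rw [hfP v hv]
      rw [memP] at hv
      rcases hv with rfl | rfl | rfl <;> assumption
    · rw [hfn v hv]; exact (hgc v hv).1
  · intro a b hab
    by_cases ha : a ∈ P
    · intro e
      exact hPind a ha b (hfc b (by rw [← e, hfP a ha])) hab
    · by_cases hb : b ∈ P
      · intro e
        exact ha (hfc a (by rw [e, hfP b hb]))
      · rw [hfn a ha, hfn b hb]
        exact hg2 a (by simp [ha]) b (by simp [hb]) hab.ne (Or.inl hab)
  · intro φ hφ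
    have hφP : ∀ v ∈ P, φ v ∈ P := fun v hv => hfc _ (by rw [hφ, hfP v hv])
    have hφW : ∀ v ∈ W, φ v = v := by
      intro v hv
      by_contra hne
      have h1 := Wimg φ hφP v hv
      have h2 := hφ v
      rw [hfn _ (hWP _ h1), hfn _ (hWP _ hv)] at h2
      exact hg2 _ (by simp [hWP _ h1]) _ (by simp [hWP _ hv]) hne (Or.inr (Or.inr ⟨h1, hv⟩)) h2
    have hφy := hφW y hyW
    have hφt := hφW t htW
    have adjy : ∀ v, G.Adj y v → G.Adj y (φ v) := fun v h => by
      have := φ.map_adj_iff.2 h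
      rwa [hφy] at this
    have adjt : ∀ v, G.Adj t v → G.Adj t (φ v) := fun v h => by
      have := φ.map_adj_iff.2 h
      rwa [hφt] at this
    have hφx : φ x = x :=
      hC4 y t (φ x) x hyt (adjy x hyx) (adjt x hxt.symm) hyx hxt.symm
    have hφz : φ z = z := by
      have h1 := hφP z hzP
      rw [memP] at h1
      rcases h1 with h1 | h1 | h1
      · rw [← hφx] at h1
        exact absurd (φ.injective h1) hzx
      · exact h1
      · have h2 := adjy z hzy.symm
        rw [h1] at h2
        exact absurd (hC4 y t x u hyt hyx hxt.symm h2 htu) hxu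
    have hφu : φ u = u := by
      have h1 := hφP u huP
      rw [memP] at h1
      rcases h1 with h1 | h1 | h1
      · rw [← hφx] at h1
        exact absurd (φ.injective h1) hxu.symm
      · rw [← hφz] at h1
        exact absurd (φ.injective h1) hzu'.symm
      · exact h1
    have hφP' : ∀ v ∈ P, φ v = v := by
      intro v hv
      rw [memP] at hv
      rcases hv with rfl | rfl | rfl <;> assumption
    refine fix hG x f φ hφ hφx ?_
    intro a b _ _ hab hs
    by_cases h1 : φ a = a
    · exact Or.inl h1
    by_cases h2 : φ b = b
    · exact Or.inr (Or.inl h2)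
    have ha : a ∉ P := fun h => h1 (hφP' a h)
    have hb : b ∉ P := fun h => h2 (hφP' b h)
    right; right
    rw [hfn a ha, hfn b hb]
    refine hg2 a (by simp [ha]) b (by simp [hb]) hab (Or.inr (Or.inl ⟨hs, ⟨?_, ?_⟩, ?_, ?_⟩))
    · rintro rfl; exact h1 hφy
    · rintro rfl; exact h1 hφt
    · rintro rfl; exact h2 hφy
    · rintro rfl; exact h2 hφt

/-- A connected regular graph with two distinct twins in which two common neighbors force
twins is complete bipartite. -/
theorem twins_iso (hG : G.Connected) (hn : 3 ≤ n) (hd : ∀ v, #(G.neighborFinset v) = n)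
    (htri : ∀ a b c, G.Adj a b → G.Adj b c → ¬ G.Adj a c)
    (htw : ∀ a b p q, a ≠ b → p ≠ q → G.Adj a p → G.Adj b p → G.Adj a q → G.Adj b q →
      ∀ r, G.Adj a r → G.Adj b r)
    {a b : V} (hab : a ≠ b) (h : ∀ r, G.Adj a r → G.Adj b r) :
    Nonempty (G ≃g completeBipartiteGraph (Fin n) (Fin n)) := by
  have h1 : ∀ p q, G.Adj a p → G.Adj a q → ∀ r, G.Adj p r → G.Adj q r := by
    intro p q hp hq
    by_cases hpq : p = q
    · subst hpq; exact fun _ h => h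
    · exact htw p q a b hpq hab hp.symm hq.symm (h p hp).symm (h q hq).symm
  obtain ⟨m, hm⟩ : (G.neighborFinset a).Nonempty := by rw [← card_pos, hd]; omega
  rw [mem_neighborFinset] at hm
  -- `v` adjacent to `m` has the same neighbors as `a`
  have h2 : ∀ v, G.Adj m v → ∀ r, G.Adj a r ↔ G.Adj v r := by
    intro v hv
    have hsub : G.neighborFinset a ⊆ G.neighborFinset v := by
      intro r hr
      rw [mem_neighborFinset] at hr ⊢
      exact (h1 m r hm hr v hv).symm
    have := eq_of_subset_of_card_le hsub (by rw [hd, hd])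
    intro r
    rw [← mem_neighborFinset, this, mem_neighborFinset]
  have hclosed : ∀ u v, G.Reachable u v → (G.Adj a u ∨ G.Adj m u) → (G.Adj a v ∨ G.Adj m v) := by
    rintro u v ⟨w⟩
    induction w with
    | nil => exact id
    | cons hadj _ ih =>
      intro hu
      apply ih
      rcases hu with hu | hu
      · exact Or.inr (h1 _ m hu hm _ hadj)
      · exact Or.inl ((h2 _ hu _).2 hadj)
  have hall : ∀ v, ¬ G.Adj a v ↔ G.Adj m v := by
    intro v
    have := hclosed a v (hG.preconnected a v) (Or.inr hm.symm)
    have h3 : G.Adj a v → ¬ G.Adj m v := fun h h' => htri a m v hm h' h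
    tauto
  have hadj : ∀ u v, G.Adj u v ↔ ((G.Adj a u ∧ ¬ G.Adj a v) ∨ (¬ G.Adj a u ∧ G.Adj a v)) := by
    intro u v
    by_cases hu : G.Adj a u
    · have e : G.Adj u v ↔ G.Adj m v := ⟨h1 u m hu hm v, h1 m u hm hu v⟩
      rw [e, hall]; simp [hu, ← hall]
    · have e := h2 u ((hall u).1 hu) v
      rw [← e]; simp [hu]
  classical
  have c1 : Fintype.card {v // G.Adj a v} = n := by
    rw [← hd a, Fintype.card_subtype]
    congr 1; ext v; simp
  have c2 : Fintype.card {v // ¬ G.Adj a v} = n := by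
    rw [← hd m, Fintype.card_subtype]
    congr 1; ext v; simp [hall]
  let e1 := Fintype.equivFinOfCardEq c1
  let e2 := Fintype.equivFinOfCardEq c2
  let e0 : V ≃ {v // G.Adj a v} ⊕ {v // ¬ G.Adj a v} := (Equiv.sumCompl (G.Adj a)).symm
  have key : ∀ s r, (completeBipartiteGraph {v // G.Adj a v} {v // ¬ G.Adj a v}).Adj s r ↔
      G.Adj (e0.symm s) (e0.symm r) := by
    rintro (⟨s, hs⟩ | ⟨s, hs⟩) (⟨r, hr⟩ | ⟨r, hr⟩) <;>
      simp [e0, hadj s r, hs, hr]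
  let i0 : G ≃g completeBipartiteGraph {v // G.Adj a v} {v // ¬ G.Adj a v} :=
    ⟨e0, by intro u v; rw [key]; simp⟩
  exact ⟨i0.trans (completeBipartiteGraphCongr e1 e2)⟩

theorem main (hG : G.Connected) (hn : 3 ≤ n) (hd : ∀ v, #(G.neighborFinset v) ≤ n)
    (hmax : ∃ v, #(G.neighborFinset v) = n)
    (hL : ∀ v, #(L v) = 2 * n - 1)
    (hK : ¬ Nonempty (G ≃g completeBipartiteGraph (Fin n) (Fin n))) : Good G L := by
  by_contra hbad
  have hb : ∀ x y, G.Adj x y →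
      2 * n - 2 ≤ #((G.neighborFinset y).erase x ∪ (G.neighborFinset x).erase y) := by
    intro x y hxy
    by_contra hlt
    exact hbad (case_b hG hn hd hL hxy (by omega))
  obtain ⟨v0, hv0⟩ := hmax
  have hnbr : ∀ v, ∃ w, G.Adj v w := by
    intro v
    by_cases h : v = v0
    · subst h
      obtain ⟨w, hw⟩ : (G.neighborFinset v).Nonempty := by rw [← card_pos, hv0]; omega
      exact ⟨w, by simpa using hw⟩
    · obtain ⟨p, hp, _⟩ := exists_down hG h
      exact ⟨p, hp.symm⟩
  have hcards : ∀ x y, G.Adj x y → #((G.neighborFinset y).erase x) + 1 = #(G.neighborFinset y) :=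
    fun x y hxy => card_erase_add_one (by simpa using hxy.symm)
  have hreg : ∀ v, #(G.neighborFinset v) = n := by
    intro v
    obtain ⟨w, hw⟩ := hnbr v
    have h1 := hb v w hw
    have h2 := card_union_le ((G.neighborFinset w).erase v) ((G.neighborFinset v).erase w)
    have h3 := hcards v w hw
    have h4 := hcards w v hw.symm
    have h5 := hd v
    have h6 := hd w
    omega
  have htri : ∀ a b c, G.Adj a b → G.Adj b c → ¬ G.Adj a c := by
    intro a b c hab hbc hac
    have h1 := hb a b hab
    have h2 := card_union_add_card_inter ((G.neighborFinset b).erase a)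
      ((G.neighborFinset a).erase b)
    have h3 := hcards a b hab
    have h4 := hcards b a hab.symm
    have h5 := hd a
    have h6 := hd b
    have h7 : 0 < #((G.neighborFinset b).erase a ∩ (G.neighborFinset a).erase b) :=
      card_pos.2 ⟨c, by simp [hac.ne.symm, hbc.ne.symm, hac, hbc]⟩
    omega
  have hlist : ∀ x y z, G.Adj x y → G.Adj y z → x ≠ z → L x ⊆ L z := by
    intro x y z hxy hyz hxz c hc
    by_contra hcz
    refine hbad (case_c hG hn hd hL hc hxy hyz hxz (htri x y z hxy hyz)
      (((G.neighborFinset y).erase x).erase z) ?_ ?_)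
    · intro u h1 h2 h3 _
      simp [h1, h2, h3]
    · have m1 : x ∈ G.neighborFinset y := by simpa using hxy.symm
      have m2 : z ∈ (G.neighborFinset y).erase x := by simp [hxz.symm, hyz]
      rw [card_erase_of_mem m2, card_erase_of_mem m1, hreg, erase_eq_of_notMem hcz, hL]
      omega
  have htw : ∀ a b p q, a ≠ b → p ≠ q → G.Adj a p → G.Adj b p → G.Adj a q → G.Adj b q →
      ∀ r, G.Adj a r → G.Adj b r := by
    intro y w x z hyw hxz hyx hwx hyz hwz r hyr
    by_contra hwr
    have hrx : r ≠ x := by rintro rfl; exact hwr hwx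
    have hrz : r ≠ z := by rintro rfl; exact hwr hwz
    obtain ⟨c, hc⟩ : (L x).Nonempty := by rw [← card_pos, hL]; omega
    refine hbad (case_c hG hn hd hL hc hyx.symm hyz hxz (htri x y z hyx.symm hyz)
      ((((G.neighborFinset y).erase x).erase z).erase r) ?_ ?_)
    · intro u h1 h2 h3 hs
      have hur : u ≠ r := by
        rintro rfl
        refine hwr ((hs.2 w ?_).2 hwz)
        rw [dist_eq_one_iff_adj.2 hwx.symm]
        exact hG.one_lt_dist_of_ne_of_not_adj hxz (htri x y z hyx.symm hyz)
      simp [h1, h2, h3, hur]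
    · have m1 : x ∈ G.neighborFinset y := by simpa using hyx
      have m2 : z ∈ (G.neighborFinset y).erase x := by simp [hxz.symm, hyz]
      have m3 : r ∈ ((G.neighborFinset y).erase x).erase z := by simp [hrx, hrz, hyr]
      have h0 := pred_card_le_card_erase (s := L z) (a := c)
      rw [hL] at h0
      rw [card_erase_of_mem m3, card_erase_of_mem m2, card_erase_of_mem m1, hreg]
      omega
  have hC4 : ∀ a b p q, a ≠ b → G.Adj a p → G.Adj b p → G.Adj a q → G.Adj b q → p = q := by
    intro a b p q hab h1 h2 h3 h4
    by_contra hpq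
    exact hK (twins_iso hG hn hreg htri htw hab (htw a b p q hab hpq h1 h2 h3 h4))
  -- choose the path
  have hex : ∀ v w, ∃ r, G.Adj v r ∧ r ≠ w := by
    intro v w
    obtain ⟨r, hr, hne⟩ := exists_mem_ne (s := G.neighborFinset v) (by rw [hreg]; omega) w
    exact ⟨r, by simpa using hr, hne⟩
  obtain ⟨y, hxy⟩ := hnbr v0
  obtain ⟨z, hyz, hzx⟩ := hex y v0
  obtain ⟨t, hxt, hty⟩ := hex v0 y
  obtain ⟨u, htu, hux, hzu⟩ : ∃ u, G.Adj t u ∧ u ≠ v0 ∧ ¬ G.Adj z u := by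
    have m1 : v0 ∈ G.neighborFinset t := by simpa using hxt.symm
    obtain ⟨u1, h1, u2, h2, h12⟩ := one_lt_card.1
      (show 1 < #((G.neighborFinset t).erase v0) by rw [card_erase_of_mem m1, hreg]; omega)
    simp only [mem_erase, mem_neighborFinset] at h1 h2
    by_cases hz1 : G.Adj z u1
    · refine ⟨u2, h2.2, h2.1, fun hz2 => h12 (hC4 t z u1 u2 ?_ h1.2 hz1 h2.2 hz2)⟩
      rintro rfl
      exact htri _ _ _ hxy hyz hxt
    · exact ⟨u1, h1.2, h1.1, hz1⟩
  obtain ⟨c, hc⟩ : (L v0).Nonempty := by rw [← card_pos, hL]; omega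
  exact hbad (case_d hG hn hd hL htri hC4 hyz.symm hxy.symm hxt htu hzx hty.symm hux.symm hzu hc
    (hlist _ _ _ hxy hyz hzx.symm hc) (hlist _ _ _ hxt htu hux.symm hc))

end cases

end ListDist

theorem stmt_8 {V : Type*} [Fintype V] (G : SimpleGraph V) [DecidableRel G.Adj]
    (hconn : G.Connected) (hΔ : 3 ≤ G.maxDegree)
    (hnotK : ¬ Nonempty
      (G ≃g completeBipartiteGraph (Fin G.maxDegree) (Fin G.maxDegree))) :
    listDistChromNum G ≤ 2 * G.maxDegree - 1 := by
  classical
  refine Nat.sInf_le ?_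
  intro L hL
  haveI := hconn.nonempty
  obtain ⟨v, hv⟩ := G.exists_maximal_degree_vertex
  exact ListDist.main hconn hΔ (fun v => G.degree_le_maxDegree v) ⟨v, hv.symm⟩ hL hnotK
end

section
/- Let G be a connected finite unicyclic graph (a connected graph with exactly one cycle) whose girth is at least 7 and whose maximum degree Δ(G) is at least 3. Then the list-distinguishing chromatic number of G is at most Δ(G). -/
open SimpleGraph

/-- Extract a periodic parametrization of a cycle. -/
lemma exists_cycle_param {V : Type*} (G : SimpleGraph V) (hgirth : 7 ≤ G.girth) :
    ∃ (n : ℕ) (c : ℕ → V), 3 ≤ n ∧ (∀ i j, c i = c j ↔ i % n = j % n) ∧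
      ∀ i, G.Adj (c i) (c (i + 1)) := by
  have hna : ¬ G.IsAcyclic := by
    intro h
    rw [SimpleGraph.girth_eq_zero.2 h] at hgirth
    omega
  obtain ⟨a, w, hw, -⟩ := SimpleGraph.exists_girth_eq_length.2 hna
  have h3 := hw.three_le_length
  have hinj : ∀ i j, i < w.length → j < w.length → w.getVert i = w.getVert j → i = j := by
    intro i j hi hj h
    exact hw.getVert_injOn' (by simp; omega) (by simp; omega) h
  refine ⟨w.length, fun i => w.getVert (i % w.length), h3, ?_, ?_⟩
  · intro i j
    constructor
    · intro h
      exact hinj _ _ (Nat.mod_lt _ (by omega)) (Nat.mod_lt _ (by omega)) h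
    · intro h
      simp only [h]
  · intro i
    have hlt : i % w.length < w.length := Nat.mod_lt _ (by omega)
    have hadj := w.adj_getVert_succ hlt
    show G.Adj (w.getVert (i % w.length)) (w.getVert ((i + 1) % w.length))
    by_cases h : i % w.length + 1 = w.length
    · have : (i + 1) % w.length = 0 := by
        rw [Nat.add_mod, Nat.mod_eq_of_lt (show 1 < w.length by omega), h, Nat.mod_self]
      rw [this]
      rw [h] at hadj
      simpa using hadj
    · have : (i + 1) % w.length = i % w.length + 1 := by
        rw [Nat.add_mod, Nat.mod_eq_of_lt (show 1 < w.length by omega)]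
        exact Nat.mod_eq_of_lt (by omega)
      rw [this]
      exact hadj

/-- A connected unicyclic graph is a functional graph. -/
lemma exists_functional {V : Type*} [Fintype V] (G : SimpleGraph V) [DecidableRel G.Adj]
    (hconn : G.Connected) (huni : G.edgeFinset.card = Fintype.card V)
    (n : ℕ) (c : ℕ → V) (hn : 3 ≤ n) (hc : ∀ i j, c i = c j ↔ i % n = j % n)
    (hadj : ∀ i, G.Adj (c i) (c (i + 1))) :
    ∃ (σ : V → V) (d : V → ℕ), (∀ i, σ (c i) = c (i + 1)) ∧ (∀ v, d v = 0 ↔ ∃ i, v = c i) ∧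
      (∀ v, d v ≠ 0 → d v = d (σ v) + 1) ∧ ∀ u v, G.Adj u v ↔ (v = σ u ∨ u = σ v) := by
  classical
  let D : V → Set ℕ := fun v => {k | ∃ i, ∃ w : G.Walk v (c i), w.length = k}
  have hD : ∀ v, (D v).Nonempty := by
    intro v
    obtain ⟨w⟩ := hconn.preconnected v (c 0)
    exact ⟨_, 0, w, rfl⟩
  let d : V → ℕ := fun v => sInf (D v)
  have hd0 : ∀ v, d v = 0 ↔ ∃ i, v = c i := by
    intro v
    constructor
    · intro h
      obtain ⟨i, w, hw⟩ := Nat.sInf_mem (hD v)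
      change w.length = d v at hw
      rw [h] at hw
      exact ⟨i, SimpleGraph.Walk.eq_of_length_eq_zero hw⟩
    · rintro ⟨i, rfl⟩
      have : 0 ∈ D (c i) := ⟨i, SimpleGraph.Walk.nil, rfl⟩
      have := Nat.sInf_le this
      change d (c i) ≤ 0 at this
      omega
  have hpar : ∀ v, d v ≠ 0 → ∃ u, G.Adj v u ∧ d v = d u + 1 := by
    intro v hv
    obtain ⟨i, w, hw⟩ := Nat.sInf_mem (hD v)
    change w.length = d v at hw
    cases w with
    | nil => simp at hw; omega
    | @cons _ u _ h q =>
      refine ⟨u, h, ?_⟩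
      have h1 : d u ≤ q.length := Nat.sInf_le ⟨i, q, rfl⟩
      obtain ⟨j, w', hw'⟩ := Nat.sInf_mem (hD u)
      change w'.length = d u at hw'
      have h2 : d v ≤ (SimpleGraph.Walk.cons h w').length := Nat.sInf_le ⟨j, _, rfl⟩
      simp at h2 hw
      omega
  have hσ : ∀ v, ∃ u, G.Adj v u ∧ (d v ≠ 0 → d v = d u + 1) ∧ ∀ i, v = c i → u = c (i + 1) := by
    intro v
    by_cases hv : d v = 0
    · obtain ⟨i, rfl⟩ := (hd0 v).1 hv
      refine ⟨c (i + 1), hadj i, fun h => absurd hv h, ?_⟩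
      intro j hj
      rw [hc] at hj ⊢
      exact Nat.ModEq.add_right 1 hj
    · obtain ⟨u, h1, h2⟩ := hpar v hv
      exact ⟨u, h1, fun _ => h2, fun i hi => absurd ((hd0 v).2 ⟨i, hi⟩) hv⟩
  choose σ hσ1 hσ2 hσ3 using hσ
  refine ⟨σ, d, fun i => hσ3 _ i rfl, hd0, hσ2, ?_⟩
  have hinj : Function.Injective (fun v => (⟨s(v, σ v), hσ1 v⟩ : G.edgeSet)) := by
    intro v w h
    have h' : s(v, σ v) = s(w, σ w) := congrArg Subtype.val h
    rw [Sym2.eq_iff] at h'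
    rcases h' with ⟨h, -⟩ | ⟨h1, h2⟩
    · exact h
    · exfalso
      have hz : ∀ x, d x = 0 → d (σ x) = 0 := by
        intro x hx
        obtain ⟨i, hi⟩ := (hd0 x).1 hx
        exact (hd0 _).2 ⟨i + 1, hσ3 x i hi⟩
      by_cases hv : d v = 0
      · obtain ⟨i, hi⟩ := (hd0 v).1 hv
        have e1 := hσ3 v i hi
        rw [h2] at e1
        have e2 := hσ3 w _ e1
        rw [← h1, hi, hc] at e2
        have : i + 0 ≡ i + 2 [MOD n] := e2
        have := Nat.ModEq.add_left_cancel' i this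
        unfold Nat.ModEq at this
        rw [Nat.mod_eq_of_lt (show 2 < n by omega)] at this
        simp at this
      · have e1 := hσ2 v hv
        have hw : d w ≠ 0 := by
          intro hw
          have := hz w hw
          rw [← h1] at this
          exact hv this
        have e2 := hσ2 w hw
        rw [h2] at e1
        rw [← h1] at e2
        omega
  have hcard : Fintype.card V = Fintype.card G.edgeSet := by
    rw [← huni, SimpleGraph.edgeFinset_card]
  have hsurj := ((Fintype.bijective_iff_injective_and_card _).2 ⟨hinj, hcard⟩).2
  intro u v
  constructor
  · intro h
    obtain ⟨x, hx⟩ := hsurj ⟨s(u, v), h⟩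
    have hx' : s(x, σ x) = s(u, v) := congrArg Subtype.val hx
    rw [Sym2.eq_iff] at hx'
    rcases hx' with ⟨rfl, rfl⟩ | ⟨rfl, rfl⟩
    · exact Or.inl rfl
    · exact Or.inr rfl
  · rintro (rfl | rfl)
    · exact hσ1 u
    · exact (hσ1 v).symm

/-- Greedy choice of distinct colors avoiding `a`. -/
lemma greedy_inj {V : Type*} [DecidableEq V] (L : V → Finset ℕ) (k : ℕ) (hL : ∀ v, (L v).card = k)
    (a : ℕ) (A : Finset V) (hA : A.card + 1 ≤ k) :
    ∃ g : V → ℕ, (∀ u ∈ A, g u ∈ L u ∧ g u ≠ a) ∧ ∀ u ∈ A, ∀ w ∈ A, g u = g w → u = w := by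
  induction A using Finset.induction_on with
  | empty => exact ⟨fun _ => 0, by simp, by simp⟩
  | insert x A hx ih =>
    rw [Finset.card_insert_of_notMem hx] at hA
    obtain ⟨g, h1, h2⟩ := ih (by omega)
    obtain ⟨y, hy1, hy2⟩ : ∃ y ∈ L x, y ∉ insert a (A.image g) := by
      apply Finset.exists_mem_notMem_of_card_lt_card
      have := Finset.card_insert_le a (A.image g)
      have := Finset.card_image_le (s := A) (f := g)
      rw [hL]
      omega
    simp only [Finset.mem_insert, Finset.mem_image, not_or, not_exists, not_and] at hy2
    have hg : ∀ u ∈ A, Function.update g x y u = g u := by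
      intro u hu
      exact Function.update_of_ne (by rintro rfl; exact hx hu) _ _
    refine ⟨Function.update g x y, ?_, ?_⟩
    · intro u hu
      rcases Finset.mem_insert.1 hu with rfl | hu
      · simp [hy1, hy2.1]
      · rw [hg u hu]
        exact h1 u hu
    · intro u hu w hw
      rcases Finset.mem_insert.1 hu with rfl | hu1 <;> rcases Finset.mem_insert.1 hw with rfl | hw1
      · simp
      · rw [hg w hw1]
        simp only [Function.update_self]
        intro h
        exact absurd h.symm (hy2.2 w hw1)
      · rw [hg u hu1]
        simp only [Function.update_self]
        intro h
        exact absurd h (hy2.2 u hu1)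
      · rw [hg u hu1, hg w hw1]
        exact h2 u hu1 w hw1

/-- Greedy choice of distinct colors avoiding `a`, with color set different from `S`. -/
lemma greedy_inj_ne {V : Type*} [DecidableEq V] (L : V → Finset ℕ) (k : ℕ)
    (hL : ∀ v, (L v).card = k) (S : Finset ℕ) (hS : S.Nonempty)
    (a : ℕ) (A : Finset V) (hA : A.card + 2 ≤ k) :
    ∃ g : V → ℕ, (∀ u ∈ A, g u ∈ L u ∧ g u ≠ a) ∧ (∀ u ∈ A, ∀ w ∈ A, g u = g w → u = w) ∧
      A.image g ≠ S := by
  rcases A.eq_empty_or_nonempty with rfl | ⟨x, hx⟩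
  · exact ⟨fun _ => 0, by simp, by simp, by simpa using hS.ne_empty.symm⟩
  have hcard : (A.erase x).card + 1 = A.card := Finset.card_erase_add_one hx
  obtain ⟨g, h1, h2⟩ := greedy_inj L k hL a (A.erase x) (by omega)
  set T := (A.erase x).image g with hT
  have hTc : T.card ≤ (A.erase x).card := Finset.card_image_le
  have hgo : ∀ y ∈ L x, y ∉ insert a T → (∀ u ∈ A, Function.update g x y u ∈ L u ∧
      Function.update g x y u ≠ a) ∧ (∀ u ∈ A, ∀ w ∈ A,
      Function.update g x y u = Function.update g x y w → u = w) ∧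
      A.image (Function.update g x y) = insert y T := by
    intro y hy1 hy2
    simp only [hT, Finset.mem_insert, Finset.mem_image, not_or, not_exists, not_and] at hy2
    have hg : ∀ u ≠ x, Function.update g x y u = g u := fun u hu => Function.update_of_ne hu _ _
    refine ⟨?_, ?_, ?_⟩
    · intro u hu
      by_cases hux : u = x
      · subst hux
        simp [hy1, hy2.1]
      · rw [hg u hux]
        exact h1 u (Finset.mem_erase.2 ⟨hux, hu⟩)
    · intro u hu w hw
      by_cases hux : u = x <;> by_cases hwx : w = x
      · simp [hux, hwx]
      · rw [hg w hwx, hux]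
        simp only [Function.update_self]
        intro h
        exact absurd h.symm (hy2.2 w (Finset.mem_erase.2 ⟨hwx, hw⟩))
      · rw [hg u hux, hwx]
        simp only [Function.update_self]
        intro h
        exact absurd h (hy2.2 u (Finset.mem_erase.2 ⟨hux, hu⟩))
      · rw [hg u hux, hg w hwx]
        exact h2 u (Finset.mem_erase.2 ⟨hux, hu⟩) w (Finset.mem_erase.2 ⟨hwx, hw⟩)
    · conv_lhs => rw [← Finset.insert_erase hx]
      rw [Finset.image_insert, Function.update_self, hT]
      congr 1
      apply Finset.image_congr
      intro u hu
      exact hg u (Finset.ne_of_mem_erase hu)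
  obtain ⟨y, hy1, hy2⟩ : ∃ y ∈ L x, y ∉ insert a T := by
    apply Finset.exists_mem_notMem_of_card_lt_card
    have := Finset.card_insert_le a T
    rw [hL]
    omega
  obtain ⟨z, hz1, hz2⟩ : ∃ z ∈ L x, z ∉ insert y (insert a T) := by
    apply Finset.exists_mem_notMem_of_card_lt_card
    have := Finset.card_insert_le a T
    have := Finset.card_insert_le y (insert a T)
    rw [hL]
    omega
  rw [Finset.mem_insert, not_or] at hz2
  obtain ⟨a1, a2, a3⟩ := hgo y hy1 hy2
  obtain ⟨b1, b2, b3⟩ := hgo z hz1 hz2.2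
  by_cases hyS : insert y T = S
  · refine ⟨_, b1, b2, ?_⟩
    rw [b3, ← hyS]
    intro h
    have : z ∈ insert y T := by rw [← h]; exact Finset.mem_insert_self _ _
    rcases Finset.mem_insert.1 this with h | h
    · exact hz2.1 h
    · exact hz2.2 (Finset.mem_insert_of_mem h)
  · exact ⟨_, a1, a2, by rw [a3]; exact hyS⟩

/-- Coloring of the cycle. -/
lemma cycle_coloring {V : Type*} (L : V → Finset ℕ) (k : ℕ) (hk : 3 ≤ k)
    (hL : ∀ v, (L v).card = k) (n : ℕ) (c : ℕ → V) (hn : 3 ≤ n)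
    (hc : ∀ i j, c i = c j ↔ i % n = j % n) :
    ∃ f : V → ℕ, (∀ i, f (c i) ∈ L (c i)) ∧ (∀ i, f (c i) ≠ f (c (i + 1))) ∧
      f (c 1) ≠ f (c (n - 1)) := by
  classical
  have hex : ∀ v a b, ∃ x ∈ L v, x ≠ a ∧ x ≠ b := by
    intro v a b
    obtain ⟨x, hx, hx'⟩ : ∃ x ∈ L v, x ∉ ({a, b} : Finset ℕ) := by
      apply Finset.exists_mem_notMem_of_card_lt_card
      have := Finset.card_le_two (a := a) (b := b)
      rw [hL]
      omega
    simp at hx'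
    exact ⟨x, hx, hx'⟩
  choose P hP1 hP2 hP3 using hex
  let b : ℕ := P (c (n - 1)) 0 0
  let h : ℕ → ℕ := fun i => Nat.rec (P (c 0) b b) (fun i x => P (c (i + 1)) x b) i
  have hs : ∀ i, h (i + 1) = P (c (i + 1)) (h i) b := fun i => rfl
  have hb : ∀ i, h i ≠ b := by
    intro i
    cases i with
    | zero => exact hP2 _ _ _
    | succ i => rw [hs]; exact hP3 _ _ _
  have hm : ∀ i, h i ∈ L (c i) := by
    intro i
    cases i with
    | zero => exact hP1 _ _ _
    | succ i => rw [hs]; exact hP1 _ _ _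
  have hne : ∀ i, h i ≠ h (i + 1) := by
    intro i
    rw [hs]
    exact (hP2 _ _ _).symm
  let q : ℕ → ℕ := fun i => if i = n - 1 then b else h i
  let f : V → ℕ := fun v => if hv : ∃ i, v = c i then q (hv.choose % n) else 0
  have hf : ∀ i, f (c i) = q (i % n) := by
    intro i
    have hv : ∃ j, c i = c j := ⟨i, rfl⟩
    have : f (c i) = q (hv.choose % n) := dif_pos hv
    rw [this]
    congr 1
    exact ((hc _ _).1 hv.choose_spec).symm
  have hcm : ∀ i, c (i % n) = c i := by
    intro i
    rw [hc, Nat.mod_mod]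
  refine ⟨f, ?_, ?_, ?_⟩
  · intro i
    rw [hf, ← hcm i]
    simp only [q]
    split_ifs with hi
    · rw [hi]
      exact hP1 _ _ _
    · exact hm _
  · intro i
    rw [hf, hf]
    have hlt : i % n < n := Nat.mod_lt _ (by omega)
    by_cases hi : i % n + 1 = n
    · have : (i + 1) % n = 0 := by
        rw [Nat.add_mod, Nat.mod_eq_of_lt (show 1 < n by omega), hi, Nat.mod_self]
      rw [this]
      simp only [q]
      rw [if_pos (by omega), if_neg (by omega)]
      exact (hb 0).symm
    · have : (i + 1) % n = i % n + 1 := by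
        rw [Nat.add_mod, Nat.mod_eq_of_lt (show 1 < n by omega)]
        exact Nat.mod_eq_of_lt (by omega)
      rw [this]
      simp only [q]
      rw [if_neg (by omega)]
      split_ifs
      · exact hb _
      · exact hne _
  · rw [hf, hf, Nat.mod_eq_of_lt (show 1 < n by omega), Nat.mod_eq_of_lt (show n - 1 < n by omega)]
    simp only [q]
    rw [if_neg (by omega), if_pos trivial]
    exact hb 1

theorem stmt_11 {V : Type*} [Fintype V] (G : SimpleGraph V) [DecidableRel G.Adj]
    (hconn : G.Connected) (huni : G.edgeFinset.card = Fintype.card V)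
    (hgirth : 7 ≤ G.girth) (hΔ : 3 ≤ G.maxDegree) :
    listDistChromNum G ≤ G.maxDegree := by
  classical
  apply Nat.sInf_le
  intro L hL
  obtain ⟨n, c₀, hn, hc₀, hadj₀⟩ := exists_cycle_param G hgirth
  obtain ⟨σ, d, hσ₀, hd₀, hdσ, hG⟩ := exists_functional G hconn huni n c₀ hn hc₀ hadj₀
  -- a vertex off the cycle
  have hout : ∃ v, d v = 1 := by
    have h1 : ∃ v, d v ≠ 0 := by
      by_contra! hall
      have := hconn.nonempty
      obtain ⟨v, hv⟩ := G.exists_maximal_degree_vertex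
      obtain ⟨i, rfl⟩ := (hd₀ v).1 (hall v)
      have hsub : G.neighborFinset (c₀ i) ⊆ {c₀ (i + 1), c₀ (i + (n - 1))} := by
        intro u hu
        rw [SimpleGraph.mem_neighborFinset, hG] at hu
        simp only [Finset.mem_insert, Finset.mem_singleton]
        rcases hu with rfl | hu
        · left; exact hσ₀ i
        · right
          obtain ⟨j, rfl⟩ := (hd₀ u).1 (hall u)
          rw [hσ₀, hc₀] at hu
          rw [hc₀]
          have e : j + 1 + (n - 1) = j + n := by omega
          have := Nat.ModEq.add_right (n - 1) hu
          rw [e] at this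
          unfold Nat.ModEq at this
          rw [Nat.add_mod_right] at this
          exact this.symm
      have h2 := Finset.card_le_card hsub
      have h3 := Finset.card_le_two (a := c₀ (i + 1)) (b := c₀ (i + (n - 1)))
      rw [SimpleGraph.card_neighborFinset_eq_degree, ← hv] at h2
      omega
    obtain ⟨v, hv⟩ := h1
    obtain ⟨m, hm⟩ : ∃ m, d v = m + 1 := ⟨d v - 1, by omega⟩
    clear hv
    induction m generalizing v with
    | zero => exact ⟨v, hm⟩
    | succ m ih =>
      have := hdσ v (by omega)
      exact ih (σ v) (by omega)
  obtain ⟨t, ht⟩ := hout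
  obtain ⟨j₀, hj₀⟩ := (hd₀ (σ t)).1 (by have := hdσ t (by omega); omega)
  -- shift the parametrization
  obtain ⟨c, hcdef⟩ : ∃ c : ℕ → V, ∀ i, c i = c₀ (j₀ + i) := ⟨_, fun _ => rfl⟩
  have hc : ∀ i j, c i = c j ↔ i % n = j % n := by
    intro i j
    rw [hcdef, hcdef, hc₀]
    exact ⟨fun h => Nat.ModEq.add_left_cancel' j₀ h, fun h => Nat.ModEq.add_left j₀ h⟩
  have hσ : ∀ i, σ (c i) = c (i + 1) := by
    intro i
    rw [hcdef, hcdef, hσ₀]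
    rfl
  have hd : ∀ v, d v = 0 ↔ ∃ i, v = c i := by
    intro v
    rw [hd₀]
    constructor
    · rintro ⟨i, rfl⟩
      refine ⟨i + (n - 1) * j₀, ?_⟩
      rw [hcdef, hc₀]
      have : j₀ + (i + (n - 1) * j₀) = i + n * j₀ := by
        obtain ⟨m, rfl⟩ : ∃ m, n = m + 1 := ⟨n - 1, by omega⟩
        simp only [Nat.add_sub_cancel]
        ring
      rw [this, Nat.add_mul_mod_self_left]
    · rintro ⟨i, rfl⟩
      exact ⟨_, hcdef i⟩
  have htr : σ t = c 0 := by rw [hj₀, hcdef]; rfl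
  clear hcdef hj₀ hσ₀ hd₀ hadj₀ hc₀ c₀ j₀
  have hdc : ∀ i, d (c i) = 0 := fun i => (hd _).2 ⟨i, rfl⟩
  -- children
  let ch : V → Finset V := fun v => Finset.univ.filter (fun u => σ u = v ∧ d u ≠ 0)
  have hch : ∀ v u, u ∈ ch v ↔ σ u = v ∧ d u ≠ 0 := by
    intro v u
    simp [ch]
  have hpred : ∀ i, c i = σ (c (i + (n - 1))) := by
    intro i
    rw [hσ, hc]
    have : i + (n - 1) + 1 = i + n := by omega
    rw [this, Nat.add_mod_right]
  have hcdist : ∀ i, c (i + 1) ≠ c (i + (n - 1)) := by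
    intro i h
    rw [hc] at h
    have := Nat.ModEq.add_left_cancel' i h
    unfold Nat.ModEq at this
    rw [Nat.mod_eq_of_lt (show 1 < n by omega), Nat.mod_eq_of_lt (show n - 1 < n by omega)] at this
    omega
  have hcard1 : ∀ v, (ch v).card + 1 ≤ G.maxDegree := by
    intro v
    have hnot : σ v ∉ ch v := by
      rw [hch]
      rintro ⟨h1, h2⟩
      have e1 := hdσ _ h2
      rw [h1] at e1
      by_cases hv : d v = 0
      · obtain ⟨i, rfl⟩ := (hd v).1 hv
        rw [hσ] at h2
        exact h2 (hdc _)
      · have := hdσ v hv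
        omega
    have hsub : insert (σ v) (ch v) ⊆ G.neighborFinset v := by
      intro u hu
      rw [SimpleGraph.mem_neighborFinset, hG]
      rcases Finset.mem_insert.1 hu with h | h
      · exact Or.inl h
      · exact Or.inr ((hch _ _).1 h).1.symm
    have h2 := Finset.card_le_card hsub
    rw [Finset.card_insert_of_notMem hnot, SimpleGraph.card_neighborFinset_eq_degree] at h2
    exact h2.trans (G.degree_le_maxDegree v)
  have hcard2 : ∀ i, (ch (c i)).card + 2 ≤ G.maxDegree := by
    intro i
    have hn1 : c (i + (n - 1)) ∉ ch (c i) := by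
      rw [hch]
      rintro ⟨-, h⟩
      exact h (hdc _)
    have hn2 : c (i + 1) ∉ insert (c (i + (n - 1))) (ch (c i)) := by
      rw [Finset.mem_insert, hch]
      rintro (h | ⟨-, h⟩)
      · exact hcdist i h
      · exact h (hdc _)
    have hsub : insert (c (i + 1)) (insert (c (i + (n - 1))) (ch (c i))) ⊆
        G.neighborFinset (c i) := by
      intro u hu
      rw [SimpleGraph.mem_neighborFinset, hG]
      rcases Finset.mem_insert.1 hu with h | hu
      · left; rw [h, hσ]
      rcases Finset.mem_insert.1 hu with h | h
      · right; rw [h]; exact hpred i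
      · exact Or.inr ((hch _ _).1 h).1.symm
    have h2 := Finset.card_le_card hsub
    rw [Finset.card_insert_of_notMem hn2, Finset.card_insert_of_notMem hn1,
      SimpleGraph.card_neighborFinset_eq_degree] at h2
    exact h2.trans (G.degree_le_maxDegree _)
  -- the coloring
  obtain ⟨f₀, hf₀L, hf₀p, hf₀n⟩ := cycle_coloring L _ hΔ hL n c hn hc
  obtain ⟨gr, hgr1, hgr2⟩ := greedy_inj L _ hL (f₀ (c 0)) (ch (c 0)) (hcard1 _)
  let S := (ch (c 0)).image gr
  have hS : S.Nonempty := by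
    refine ⟨gr t, Finset.mem_image_of_mem _ ?_⟩
    rw [hch]
    exact ⟨htr, by omega⟩
  have hgex : ∀ (v : V) (a : ℕ), ∃ g : V → ℕ, (v = c 0 → a = f₀ (c 0) → g = gr) ∧
      (∀ u ∈ ch v, g u ∈ L u ∧ g u ≠ a) ∧ (∀ u ∈ ch v, ∀ w ∈ ch v, g u = g w → u = w) ∧
      (∀ i, v = c i → v ≠ c 0 → (ch v).image g ≠ S) := by
    intro v a
    by_cases hv : v = c 0
    · by_cases ha : a = f₀ (c 0)
      · subst hv ha
        exact ⟨gr, fun _ _ => rfl, hgr1, hgr2, fun i _ h => absurd rfl h⟩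
      · obtain ⟨g, h1, h2⟩ := greedy_inj L _ hL a (ch v) (hcard1 _)
        exact ⟨g, fun _ h => absurd h ha, h1, h2, fun i _ h => absurd hv h⟩
    · by_cases hi : ∃ i, v = c i
      · obtain ⟨i, hi⟩ := hi
        obtain ⟨g, h1, h2, h3⟩ := greedy_inj_ne L _ hL S hS a (ch v) (by rw [hi]; exact hcard2 i)
        exact ⟨g, fun h => absurd h hv, h1, h2, fun _ _ _ => h3⟩
      · obtain ⟨g, h1, h2⟩ := greedy_inj L _ hL a (ch v) (hcard1 _)
        exact ⟨g, fun h => absurd h hv, h1, h2, fun i h => absurd ⟨i, h⟩ hi⟩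
  choose g hg0 hg1 hg2 hg3 using hgex
  let F : ℕ → V → ℕ := fun k => Nat.rec f₀ (fun _ F v => g (σ v) (F (σ v)) v) k
  have hF : ∀ k v, F (k + 1) v = g (σ v) (F k (σ v)) v := fun _ _ => rfl
  let f : V → ℕ := fun v => F (d v) v
  have hfc : ∀ i, f (c i) = f₀ (c i) := by
    intro i
    show F (d (c i)) (c i) = _
    rw [hdc]
    rfl
  have hfs : ∀ v, d v ≠ 0 → f v = g (σ v) (f (σ v)) v := by
    intro v hv
    show F (d v) v = g (σ v) (F (d (σ v)) (σ v)) v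
    rw [hdσ v hv, hF]
  have hfch : ∀ v, ∀ u ∈ ch v, f u = g v (f v) u := by
    intro v u hu
    obtain ⟨rfl, h2⟩ := (hch _ _).1 hu
    exact hfs u h2
  have hfne : ∀ v, f v ≠ f (σ v) := by
    intro v
    by_cases hv : d v = 0
    · obtain ⟨i, rfl⟩ := (hd v).1 hv
      rw [hσ, hfc, hfc]
      exact hf₀p i
    · rw [hfs v hv]
      exact (hg1 _ _ v ((hch _ _).2 ⟨rfl, hv⟩)).2
  have hfinj : ∀ u w, d u ≠ 0 → d w ≠ 0 → σ u = σ w → f u = f w → u = w := by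
    intro u w hu hw h hf
    have m1 : u ∈ ch (σ u) := (hch _ _).2 ⟨rfl, hu⟩
    have m2 : w ∈ ch (σ u) := (hch _ _).2 ⟨h.symm, hw⟩
    apply hg2 (σ u) (f (σ u)) u m1 w m2
    rw [← hfch _ u m1, ← hfch _ w m2, hf]
  have himg : ∀ v, (ch v).image f = (ch v).image (g v (f v)) := by
    intro v
    apply Finset.image_congr
    intro u hu
    exact hfch v u hu
  have himg0 : (ch (c 0)).image f = S := by
    rw [himg, hg0 (c 0) (f (c 0)) rfl (hfc 0)]
  refine ⟨f, ?_, ?_, ?_⟩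
  · intro v
    by_cases hv : d v = 0
    · obtain ⟨i, rfl⟩ := (hd v).1 hv
      rw [hfc]
      exact hf₀L i
    · rw [hfs v hv]
      exact (hg1 _ _ v ((hch _ _).2 ⟨rfl, hv⟩)).1
  · intro u w h
    rcases (hG u w).1 h with rfl | rfl
    · exact hfne u
    · exact (hfne w).symm
  -- distinguishing
  have hcyc : ∀ φ : G ≃g G, ∀ i, d (φ (c i)) = 0 := by
    intro φ
    let X : Finset V := Finset.univ.filter (fun v => d v = 0)
    obtain ⟨x, hx, hmax⟩ := Finset.exists_max_image X (fun v => d (φ v))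
      ⟨c 0, by simp [X, hdc]⟩
    have hXc : ∀ i, c i ∈ X := fun i => by simp [X, hdc]
    have hx0 : d x = 0 := by simpa [X] using hx
    obtain ⟨i, rfl⟩ := (hd x).1 hx0
    by_cases h0 : d (φ (c i)) = 0
    · intro j
      have := hmax (c j) (hXc j)
      omega
    · exfalso
      have key : ∀ j, G.Adj (c i) (c j) → φ (c j) = σ (φ (c i)) := by
        intro j hj
        have := φ.map_rel_iff.2 hj
        rcases (hG _ _).1 this with h | h
        · exact h
        · exfalso
          have hj0 := hmax (c j) (hXc j)
          by_cases hz : d (φ (c j)) = 0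
          · obtain ⟨l, hl⟩ := (hd _).1 hz
            rw [hl, hσ] at h
            rw [h] at h0
            exact h0 (hdc _)
          · have := hdσ _ hz
            rw [← h] at this
            omega
      have k1 := key (i + 1) ((hG _ _).2 (Or.inl (hσ i).symm))
      have k2 := key (i + (n - 1)) ((hG _ _).2 (Or.inr (hpred i)))
      exact hcdist i (φ.injective (k1.trans k2.symm))
  have hd0iff : ∀ (φ : G ≃g G) v, d (φ v) = 0 ↔ d v = 0 := by
    intro φ v
    constructor
    · intro h
      obtain ⟨i, hi⟩ := (hd _).1 h
      have := hcyc φ.symm i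
      rw [← hi] at this
      simpa using this
    · intro h
      obtain ⟨i, rfl⟩ := (hd _).1 h
      exact hcyc φ i
  have hchN : ∀ i u, u ∈ ch (c i) ↔ G.Adj (c i) u ∧ d u ≠ 0 := by
    intro i u
    rw [hch, hG]
    constructor
    · rintro ⟨h1, h2⟩
      exact ⟨Or.inr h1.symm, h2⟩
    · rintro ⟨h1 | h1, h2⟩
      · rw [h1, hσ] at h2
        exact absurd (hdc _) h2
      · exact ⟨h1.symm, h2⟩
  have hnb : ∀ i u, G.Adj (c i) u → d u = 0 → u = c (i + 1) ∨ u = c (i + (n - 1)) := by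
    intro i u h hu
    rcases (hG _ _).1 h with h | h
    · left; rw [h, hσ]
    · right
      obtain ⟨j, rfl⟩ := (hd u).1 hu
      rw [hσ, hc] at h
      rw [hc]
      have e : j + 1 + (n - 1) = j + n := by omega
      have := Nat.ModEq.add_right (n - 1) h
      rw [e] at this
      unfold Nat.ModEq at this
      rw [Nat.add_mod_right] at this
      exact this.symm
  intro φ hφ
  have hr : φ (c 0) = c 0 := by
    obtain ⟨i, hi⟩ := (hd _).1 (hcyc φ 0)
    by_contra hne
    have h3 := hg3 (φ (c 0)) (f (φ (c 0))) i hi hne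
    rw [← himg, ← himg0] at h3
    apply h3
    ext y
    simp only [Finset.mem_image]
    rw [hi]
    constructor
    · rintro ⟨u, hu, rfl⟩
      rw [hchN] at hu
      refine ⟨φ.symm u, (hchN _ _).2 ⟨?_, ?_⟩, ?_⟩
      · rw [← φ.map_adj_iff, hi]
        simpa using hu.1
      · rw [Ne, hd0iff]
        exact hu.2
      · rw [← hφ]
        simp
    · rintro ⟨u, hu, rfl⟩
      rw [hchN] at hu
      refine ⟨φ u, (hchN _ _).2 ⟨?_, ?_⟩, hφ u⟩
      · rw [← hi, φ.map_adj_iff]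
        exact hu.1
      · rw [Ne, hd0iff]
        exact hu.2
  have hadjφ : ∀ i, φ (c i) = c i → φ (c (i + 1)) = c (i + 1) ∨ φ (c (i + 1)) = c (i + (n - 1)) := by
    intro i hi
    apply hnb
    · have := φ.map_adj_iff.2 ((hG (c i) (c (i + 1))).2 (Or.inl (hσ i).symm))
      rwa [hi] at this
    · exact hcyc φ _
  have hcfix : ∀ i, φ (c i) = c i ∧ φ (c (i + 1)) = c (i + 1) := by
    intro i
    induction i with
    | zero =>
      refine ⟨hr, ?_⟩
      rcases hadjφ 0 hr with h | h
      · exact h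
      · exfalso
        apply hf₀n
        have := hφ (c (0 + 1))
        rw [h] at this
        simp only [zero_add] at this
        rw [← hfc, ← hfc, this]
    | succ i ih =>
      refine ⟨ih.2, ?_⟩
      rcases hadjφ (i + 1) ih.2 with h | h
      · exact h
      · exfalso
        have e : c (i + 1 + (n - 1)) = c i := by
          rw [hc]
          have : i + 1 + (n - 1) = i + n := by omega
          rw [this, Nat.add_mod_right]
        rw [e] at h
        have h' := φ.injective (h.trans ih.1.symm)
        rw [hc] at h'
        have h'' : i + 2 ≡ i + 0 [MOD n] := h'
        have := Nat.ModEq.add_left_cancel' i h''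
        unfold Nat.ModEq at this
        rw [Nat.mod_eq_of_lt (show 2 < n by omega)] at this
        simp at this
  have hall : ∀ m v, d v ≤ m → φ v = v := by
    intro m
    induction m with
    | zero =>
      intro v hv
      obtain ⟨i, rfl⟩ := (hd v).1 (by omega)
      exact (hcfix i).1
    | succ m ih =>
      intro v hv
      by_cases hv0 : d v = 0
      · exact ih v (by omega)
      have e := hdσ v hv0
      have hp := ih (σ v) (by omega)
      have hadj := φ.map_adj_iff.2 ((hG (σ v) v).2 (Or.inr rfl))
      rw [hp] at hadj
      have hφ0 : d (φ v) ≠ 0 := by rw [Ne, hd0iff]; exact hv0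
      rcases (hG _ _).1 hadj with h | h
      · exfalso
        by_cases hs : d (σ v) = 0
        · obtain ⟨i, hi⟩ := (hd _).1 hs
          rw [h, hi, hσ] at hφ0
          exact hφ0 (hdc _)
        · have e2 := hdσ _ hs
          have h3 := ih (σ (σ v)) (by omega)
          have h4 := φ.injective (h.trans h3.symm)
          rw [← h4] at e2
          omega
      · exact hfinj (φ v) v hφ0 hv0 h.symm (hφ v)
  intro v
  exact hall (d v) v le_rfl
end
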